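/- The series Z(s) = ∑_{n=1}^∞ (n+1)²·(n(n+2))^{-s} converges absolutely for Re(s) > 3, and every analytic continuation f of this series to the point 0 satisfies f(0) = −1 and f'(0) = 2·ζ'(−2) + 2·ζ'(0) + log 2, where ζ' is the derivative of the Riemann zeta function. -/

import Mathlib

/-- `f` is an analytic continuation to `s₀` of the function `F` given (by an absolutely
convergent series) on the half-plane `{s : Re s > c}`. -/
def IsContinuationAt (F : ℂ → ℂ) (c : ℝ) (s₀ : ℂ) (f : ℂ → ℂ) : Prop :=
  ∃ U : Set ℂ, IsOpen U ∧ IsConnected U ∧ s₀ ∈ U ∧ {s : ℂ | c < s.re} ⊆ U ∧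
    AnalyticOnNhd ℂ f U ∧ ∀ s : ℂ, c < s.re → f s = F s

open Filter Topology Complex

/-- The coefficient `s (s + 1) ⋯ (s + k - 1) / k!` of `z ^ k` in `(1 - z) ^ (-s)`. -/
noncomputable def risingCoeff {K : Type*} [Field K] (k : ℕ) (s : K) : K :=
  ∏ j ∈ Finset.range k, (s + j) / (j + 1)

lemma norm_risingCoeff_le (k : ℕ) {s : ℂ} {R : ℝ} (h : ‖s‖ ≤ R) :
    ‖risingCoeff k s‖ ≤ risingCoeff k R := by
  unfold risingCoeff
  rw [norm_prod]
  refine Finset.prod_le_prod (fun _ _ => norm_nonneg _) fun j _ => ?_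
  have h1 : ‖(j : ℂ) + 1‖ = j + 1 := by
    rw [← Nat.cast_add_one, norm_natCast, Nat.cast_add_one]
  rw [norm_div, h1]
  gcongr
  exact (norm_add_le _ _).trans (by rw [norm_natCast]; gcongr)

lemma risingCoeff_pos (k : ℕ) {R : ℝ} (hR : 0 < R) : 0 < risingCoeff k R :=
  Finset.prod_pos fun _ _ => by positivity

lemma summable_risingCoeff_mul_pow {R x : ℝ} (hR : 0 < R) (hx : 0 < x) (hx1 : x < 1) :
    Summable fun k : ℕ => risingCoeff k R * x ^ k := by
  have hp := fun k => risingCoeff_pos k hR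
  refine summable_of_ratio_test_tendsto_lt_one hx1
    (Eventually.of_forall fun k => (mul_pos (hp k) (pow_pos hx k)).ne') ?_
  have h : ∀ k : ℕ, ‖risingCoeff (k + 1) R * x ^ (k + 1)‖ / ‖risingCoeff k R * x ^ k‖ =
      (1 + (R - 1) / ((k : ℝ) + 1)) * x := by
    intro k
    rw [Real.norm_of_nonneg (mul_pos (hp _) (pow_pos hx _)).le,
      Real.norm_of_nonneg (mul_pos (hp _) (pow_pos hx _)).le,
      show risingCoeff (k + 1) R = risingCoeff k R * ((R + k) / (k + 1)) from
        Finset.prod_range_succ _ _]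
    have := (hp k).ne'
    field_simp
    ring
  simp_rw [h]
  have h2 : Tendsto (fun k : ℕ => (R - 1) / ((k : ℝ) + 1)) atTop (𝓝 0) :=
    (tendsto_natCast_atTop_atTop.atTop_add tendsto_const_nhds).const_div_atTop _
  simpa using (h2.const_add 1).mul_const x

lemma multichoose_eq_risingCoeff (k : ℕ) (s : ℂ) : Ring.multichoose s k = risingCoeff k s := by
  have h := Ring.factorial_nsmul_multichoose_eq_ascPochhammer s k
  rw [Polynomial.ascPochhammer_smeval_eq_eval, nsmul_eq_mul] at h
  have h0 : (k.factorial : ℂ) ≠ 0 := by exact_mod_cast k.factorial_ne_zero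
  have h2 : ((k.factorial : ℕ) : ℂ) * risingCoeff k s = (ascPochhammer ℂ k).eval s := by
    clear h h0
    induction k with
    | zero => simp [risingCoeff]
    | succ k ih =>
      rw [ascPochhammer_succ_eval, ← ih, risingCoeff, Finset.prod_range_succ, ← risingCoeff,
        Nat.factorial_succ]
      have h1 : (k : ℂ) + 1 ≠ 0 := by exact_mod_cast k.succ_ne_zero
      push_cast
      field_simp
  exact mul_left_cancel₀ h0 (h.trans h2.symm)

lemma hasSum_risingCoeff_mul_pow (s : ℂ) {z : ℂ} (hz : ‖z‖ < 1) :
    HasSum (fun k : ℕ => risingCoeff k s * z ^ k) ((1 - z) ^ (-s)) := by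
  have h := (one_div_one_sub_cpow_hasFPowerSeriesOnBall_zero s).hasSum (y := z)
    (by simpa [← ofReal_norm] using hz)
  simp only [FormalMultilinearSeries.ofScalars_apply_eq, zero_add, smul_eq_mul] at h
  have hc : ∀ k : ℕ, Ring.choose (s + k - 1) k = risingCoeff k s := fun k => by
    rw [← multichoose_eq_risingCoeff, Ring.choose]
    congr 1
    ring
  simp_rw [hc] at h
  rw [cpow_neg, ← one_div]
  exact h

lemma differentiable_risingCoeff (k : ℕ) : Differentiable ℂ (risingCoeff k : ℂ → ℂ) := by
  unfold risingCoeff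
  fun_prop

lemma risingCoeff_succ_zero (k : ℕ) : risingCoeff (k + 1) (0 : ℂ) = 0 := by
  simp [risingCoeff, Finset.prod_range_succ']

lemma hasDerivAt_risingCoeff_succ_zero (k : ℕ) :
    HasDerivAt (risingCoeff (k + 1) : ℂ → ℂ) (1 / ((k : ℂ) + 1)) 0 := by
  set q : ℂ → ℂ := fun s => ∏ j ∈ Finset.range k, (s + (j + 1 : ℕ)) / ((j + 1 : ℕ) + 1) with hq
  have hqd : DifferentiableAt ℂ q 0 := by
    have : Differentiable ℂ q := by fun_prop
    exact this 0
  have hq0 : q 0 = 1 / ((k : ℂ) + 1) := by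
    rw [hq]
    clear hq hqd q
    induction k with
    | zero => simp
    | succ k ih =>
      beta_reduce at ih ⊢
      rw [Finset.prod_range_succ, ih]
      have h1 : (k : ℂ) + 1 ≠ 0 := by exact_mod_cast k.succ_ne_zero
      push_cast
      field_simp
      ring
  have h : (risingCoeff (k + 1) : ℂ → ℂ) = fun s => q s * s := by
    ext s
    rw [risingCoeff, Finset.prod_range_succ']
    simp [hq]
  rw [h, ← hq0]
  simpa using hqd.hasDerivAt.fun_mul (hasDerivAt_id' (0 : ℂ))

lemma hasSum_zeta_sub_one {w : ℂ} (hw : 1 < w.re) :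
    HasSum (fun n : ℕ => 1 / ((n : ℂ) + 2) ^ w) (riemannZeta w - 1) := by
  have hs : Summable fun n : ℕ => 1 / ((n : ℂ) + 1) ^ w := by
    simpa using (summable_nat_add_iff 1).2 (Complex.summable_one_div_nat_cpow.2 hw)
  have h := hs.hasSum
  rw [← zeta_eq_tsum_one_div_nat_add_one_cpow hw, ← hasSum_nat_add_iff' 1] at h
  simpa [add_assoc, one_add_one_eq_two] using h

lemma norm_nat_add_two_cpow (n : ℕ) (w : ℂ) : ‖((n : ℂ) + 2) ^ w‖ = ((n : ℝ) + 2) ^ w.re := by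
  have := norm_natCast_cpow_of_pos (n := n + 2) (by positivity) w
  push_cast at this
  exact this

lemma summable_one_div_nat_add_two_rpow {x : ℝ} (hx : 1 < x) :
    Summable fun n : ℕ => 1 / ((n : ℝ) + 2) ^ x := by
  simpa using (summable_nat_add_iff 2).2 (Real.summable_one_div_nat_rpow.2 hx)

lemma exists_norm_zeta_sub_one_le : ∃ C : ℝ, ∀ (k : ℕ) (w : ℂ), 2 + 2 * k ≤ w.re →
    ‖riemannZeta w - 1‖ ≤ C * (1 / 4) ^ k := by
  refine ⟨∑' n : ℕ, 1 / ((n : ℝ) + 2) ^ (2 : ℝ), fun k w hw => ?_⟩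
  have hk : (0 : ℝ) ≤ k := k.cast_nonneg
  have hs := summable_one_div_nat_add_two_rpow (x := 2) (by norm_num)
  rw [← (hasSum_zeta_sub_one (w := w) (by linarith)).tsum_eq, ← tsum_mul_right]
  refine tsum_of_norm_bounded (hs.mul_right _).hasSum fun n => ?_
  have h2 : (0 : ℝ) < n + 2 := by positivity
  rw [norm_div, norm_one, norm_nat_add_two_cpow, one_div_pow, one_div_mul_one_div]
  refine one_div_le_one_div_of_le (by positivity) ?_
  calc ((n : ℝ) + 2) ^ (2 : ℝ) * 4 ^ k ≤ ((n : ℝ) + 2) ^ (2 : ℝ) * (((n : ℝ) + 2) ^ 2) ^ k := by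
        gcongr
        nlinarith [n.cast_nonneg (α := ℝ)]
    _ = ((n : ℝ) + 2) ^ (2 + 2 * k : ℝ) := by
        rw [Real.rpow_add h2, ← pow_mul, ← Real.rpow_natCast _ (2 * k)]
        push_cast
        rfl
    _ ≤ _ := Real.rpow_le_rpow_of_exponent_le (by linarith [n.cast_nonneg (α := ℝ)]) hw

lemma sum_log_series (N : ℕ) :
    ∑ n ∈ Finset.range N, (-((n : ℝ) + 2) ^ 2 * Real.log (1 - 1 / ((n : ℝ) + 2) ^ 2) - 1) =
      Real.log 2 - 2 * Real.log (N + 1).factorial + ((N : ℝ) + 2) ^ 2 * Real.log (N + 1) -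
        ((N : ℝ) + 1) ^ 2 * Real.log (N + 2) - N := by
  induction N with
  | zero => simp
  | succ N ih =>
    have h : Real.log (1 - 1 / ((N : ℝ) + 2) ^ 2) =
        Real.log (N + 1) + Real.log (N + 3) - 2 * Real.log (N + 2) := by
      rw [← Real.log_mul (by positivity) (by positivity), ← Nat.cast_ofNat (n := 2),
        ← Real.log_pow, ← Real.log_div (by positivity) (by positivity)]
      congr 1
      push_cast
      field_simp
      ring
    have h2 : Real.log ((N + 1 + 1).factorial) =
        Real.log (N + 2) + Real.log (N + 1).factorial := by
      rw [Nat.factorial_succ (N + 1), Nat.cast_mul, Real.log_mul (by positivity) (by positivity)]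
      push_cast
      ring_nf
    rw [Finset.sum_range_succ, ih, h, h2]
    push_cast
    rw [show (N : ℝ) + 1 + 1 = N + 2 by ring, show (N : ℝ) + 1 + 2 = N + 3 by ring]
    ring

lemma tendsto_sub_sq_mul_log :
    Tendsto (fun x : ℝ => x - x ^ 2 * Real.log (1 + 1 / x)) atTop (𝓝 (1 / 2)) := by
  have h0 : Tendsto (fun x : ℝ => 2 / x) atTop (𝓝 0) := tendsto_const_nhds.div_atTop tendsto_id
  rw [tendsto_iff_norm_sub_tendsto_zero]
  refine squeeze_zero' (Eventually.of_forall fun _ => norm_nonneg _) ?_ h0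
  filter_upwards [eventually_ge_atTop 2] with x hx
  have hx0 : 0 < x := by linarith
  have hx1 : 1 / x ≤ 1 / 2 := one_div_le_one_div_of_le (by norm_num) hx
  have ha : |-(1 / x)| = 1 / x := by rw [abs_neg, abs_of_pos (by positivity)]
  have h := Real.abs_log_sub_add_sum_range_le (x := -(1 / x)) (by rw [ha]; linarith) 2
  rw [ha, sub_neg_eq_add] at h
  have h3 : (1 / x) ^ (2 + 1) / (1 - 1 / x) ≤ 2 * (1 / x) ^ 3 := by
    rw [div_le_iff₀ (by linarith)]
    nlinarith [pow_pos (one_div_pos.2 hx0) 3]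
  have h4 : x - x ^ 2 * Real.log (1 + 1 / x) - 1 / 2 =
      -x ^ 2 * (∑ i ∈ Finset.range 2, (-(1 / x)) ^ (i + 1) / (i + 1) + Real.log (1 + 1 / x)) := by
    simp [Finset.sum_range_succ]
    field_simp
    ring
  rw [h4, norm_mul, Real.norm_eq_abs, Real.norm_eq_abs, abs_neg, abs_of_pos (by positivity)]
  calc x ^ 2 * _ ≤ x ^ 2 * (2 * (1 / x) ^ 3) := by gcongr; exact h.trans h3
    _ = 2 / x := by field_simp

lemma tendsto_sum_log_series : Tendsto (fun N => ∑ n ∈ Finset.range N,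
    (-((n : ℝ) + 2) ^ 2 * Real.log (1 - 1 / ((n : ℝ) + 2) ^ 2) - 1)) atTop
    (𝓝 (3 / 2 - Real.log Real.pi)) := by
  have h1 : Tendsto (fun N : ℕ => Real.log (Stirling.stirlingSeq (N + 1))) atTop
      (𝓝 (Real.log √Real.pi)) :=
    (Stirling.tendsto_stirlingSeq_sqrt_pi.comp (tendsto_add_atTop_nat 1)).log (by positivity)
  have h2 : Tendsto (fun N : ℕ => (N : ℝ) + 1) atTop atTop :=
    tendsto_natCast_atTop_atTop.atTop_add tendsto_const_nhds
  have h3 := ((tendsto_sub_sq_mul_log.comp h2).sub (h1.const_mul 2)).add_const 1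
  rw [Real.log_sqrt Real.pi_pos.le] at h3
  convert h3 using 2 with N
  · have h4 : Real.log (1 + 1 / ((N : ℝ) + 1)) = Real.log (N + 2) - Real.log (N + 1) := by
      rw [← Real.log_div (by positivity) (by positivity)]
      congr 1
      field_simp
      ring
    rw [sum_log_series, Stirling.log_stirlingSeq_formula, Function.comp_apply, h4]
    push_cast
    rw [Real.log_mul (by positivity) (by positivity), Real.log_div (by positivity) (by positivity),
      Real.log_exp]
    ring
  · ring

lemma hasSum_zeta_two_mul_sub_one :
    HasSum (fun k : ℕ => (riemannZeta (2 * k) - 1) / ((k : ℂ) + 1)) (-Real.log Real.pi : ℝ) := by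
  let b : ℕ × ℕ → ℝ := fun p => 1 / ((p.1 : ℝ) + 2) ^ (2 * p.2 + 2) / ((p.2 : ℝ) + 2)
  have hb : Summable b := by
    refine Summable.of_nonneg_of_le (fun p => by positivity) (fun p => ?_)
      (Summable.mul_of_nonneg (summable_one_div_nat_add_two_rpow (x := 2) (by norm_num))
        (summable_geometric_of_lt_one (r := 1 / 4) (by norm_num) (by norm_num))
        (fun n => by positivity) fun k => by positivity)
    rw [one_div_pow, one_div_mul_one_div, Real.rpow_ofNat, show b p = _ from div_div _ _ _]
    refine one_div_le_one_div_of_le (by positivity) ?_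
    have h1 : (1 : ℝ) ≤ p.2 + 2 := by linarith [p.2.cast_nonneg (α := ℝ)]
    calc ((p.1 : ℝ) + 2) ^ 2 * 4 ^ p.2 ≤ ((p.1 : ℝ) + 2) ^ 2 * (((p.1 : ℝ) + 2) ^ 2) ^ p.2 := by
          gcongr
          nlinarith [p.1.cast_nonneg (α := ℝ)]
      _ = ((p.1 : ℝ) + 2) ^ (2 * p.2 + 2) := by rw [← pow_mul, ← pow_add, add_comm 2]
      _ ≤ _ := le_mul_of_one_le_right (by positivity) h1
  have hrow : ∀ n : ℕ, HasSum (fun k => b (n, k))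
      (-((n : ℝ) + 2) ^ 2 * Real.log (1 - 1 / ((n : ℝ) + 2) ^ 2) - 1) := fun n => by
    have hx : |1 / ((n : ℝ) + 2) ^ 2| < 1 := by
      rw [abs_of_pos (by positivity), div_lt_one (by positivity)]
      nlinarith [n.cast_nonneg (α := ℝ)]
    have h := (hasSum_nat_add_iff' 1).2 (Real.hasSum_pow_div_log_of_abs_lt_one hx)
    convert! h.mul_left (((n : ℝ) + 2) ^ 2) using 1
    · ext k
      simp only [b]
      push_cast
      rw [one_div_pow, ← pow_mul, add_assoc, one_add_one_eq_two]
      field_simp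
      ring
    · simp
      field_simp
  have hsum : HasSum b (3 / 2 - Real.log Real.pi) := by
    have h := hb.hasSum.prod_fiberwise hrow
    rw [tendsto_nhds_unique tendsto_sum_log_series h.tendsto_sum_nat]
    exact hb.hasSum
  have hcol : ∀ k : ℕ, HasSum (fun n => (b (n, k) : ℂ))
      ((riemannZeta (2 * (k + 1 : ℕ)) - 1) / (((k + 1 : ℕ) : ℂ) + 1)) := fun k => by
    have hk : (1 : ℝ) < (2 * ((k + 1 : ℕ) : ℂ)).re := by
      have : (2 * ((k + 1 : ℕ) : ℂ)).re = 2 * ((k + 1 : ℕ) : ℝ) := by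
        rw [show (2 * ((k + 1 : ℕ) : ℂ)) = ((2 * ((k + 1 : ℕ) : ℝ) : ℝ) : ℂ) by push_cast; rfl]
        exact ofReal_re _
      rw [this]
      push_cast
      linarith [k.cast_nonneg (α := ℝ)]
    have h := (hasSum_zeta_sub_one hk).div_const (((k + 1 : ℕ) : ℂ) + 1)
    convert! h using 1
    ext n
    simp only [b]
    rw [show (2 * ((k + 1 : ℕ) : ℂ)) = ((2 * k + 2 : ℕ) : ℂ) by push_cast; ring, cpow_natCast]
    push_cast
    ring_nf
  have hswap := ((Equiv.prodComm ℕ ℕ).hasSum_iff.2 (hasSum_ofReal.2 hsum)).prod_fiberwise hcol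
  rw [← hasSum_nat_add_iff' 1]
  convert! hswap using 1
  simp [riemannZeta_zero]
  ring

/-- The `k`-th term of the expansion of the spectral zeta function of the round 3-sphere obtained
from the binomial series of `(1 - m⁻²) ^ (-s)`. -/
noncomputable def spectralTerm (k : ℕ) (s : ℂ) : ℂ :=
  risingCoeff k s * (riemannZeta (2 * s + (2 * k - 2)) - 1)

lemma re_two_mul_add (s : ℂ) (k : ℕ) : (2 * s + (2 * k - 2)).re = 2 * s.re + (2 * k - 2) := by
  simp

lemma two_add_le_re {R : ℝ} {N : ℕ} (hN : R + 2 ≤ N) (k : ℕ) {s : ℂ} (hs : s ∈ Metric.ball 0 R) :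
    2 + 2 * k ≤ (2 * s + (2 * (k + N : ℕ) - 2)).re := by
  rw [re_two_mul_add]
  rw [mem_ball_zero_iff] at hs
  have := (abs_le.1 (Complex.abs_re_le_norm s)).1
  push_cast
  linarith

lemma exists_summable_bound {R : ℝ} (hR : 0 < R) {N : ℕ} (hN : R + 2 ≤ N) :
    ∃ u : ℕ → ℝ, Summable u ∧
      ∀ (k : ℕ) (s : ℂ), s ∈ Metric.ball 0 R → ‖spectralTerm (k + N) s‖ ≤ u k := by
  obtain ⟨C, hC⟩ := exists_norm_zeta_sub_one_le
  have hs := (summable_nat_add_iff N).2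
    (summable_risingCoeff_mul_pow hR (x := 1 / 4) (by norm_num) (by norm_num))
  refine ⟨_, hs.mul_left (C * 4 ^ N), fun k s h => ?_⟩
  have h1 := hC k _ (two_add_le_re hN k h)
  have h2 := norm_risingCoeff_le (k + N) (mem_ball_zero_iff.1 h).le
  rw [spectralTerm, norm_mul]
  calc _ ≤ risingCoeff (k + N) R * (C * (1 / 4) ^ k) := by
        gcongr
        exact (risingCoeff_pos _ hR).le
    _ = _ := by
        rw [pow_add, one_div_pow _ N]
        field_simp

lemma differentiableAt_spectralTerm {k : ℕ} {s : ℂ} (h : 2 * s + (2 * k - 2) ≠ 1) :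
    DifferentiableAt ℂ (spectralTerm k) s := by
  have h1 := DifferentiableAt.comp s (differentiableAt_riemannZeta h)
    (f := fun s : ℂ => 2 * s + (2 * (k : ℂ) - 2)) (by fun_prop)
  exact (differentiable_risingCoeff k s).fun_mul (h1.sub_const 1)

lemma differentiableOn_spectralTerm {R : ℝ} {N : ℕ} (hN : R + 2 ≤ N) (k : ℕ) :
    DifferentiableOn ℂ (spectralTerm (k + N)) (Metric.ball 0 R) := fun s hs => by
  refine (differentiableAt_spectralTerm fun h => ?_).differentiableWithinAt
  have h1 := two_add_le_re hN k hs
  rw [h, one_re] at h1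
  linarith [k.cast_nonneg (α := ℝ)]

lemma meromorphicAt_riemannZeta (s : ℂ) : MeromorphicAt riemannZeta s := by
  have h : MeromorphicAt (fun s => (s - 1)⁻¹ + riemannZeta₀ s) s := by
    have := (differentiable_riemannZeta₀.analyticAt s).meromorphicAt
    fun_prop
  refine h.congr ?_
  have hne : ∀ᶠ z in 𝓝[≠] s, z ≠ 1 := by
    rcases eq_or_ne s 1 with rfl | hs
    · exact self_mem_nhdsWithin
    · exact eventually_ne_nhdsWithin hs
  filter_upwards [hne] with z hz
  exact (riemannZeta_eq_inv_sub_add hz).symm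

lemma meromorphicAt_spectralTerm (k : ℕ) (s : ℂ) : MeromorphicAt (spectralTerm k) s := by
  have h := (meromorphicAt_riemannZeta _).comp_analyticAt
    (f := riemannZeta) (g := fun s : ℂ => 2 * s + (2 * (k : ℂ) - 2)) (x := s) (by fun_prop)
  exact ((differentiable_risingCoeff k).analyticAt s).meromorphicAt.mul
    (h.sub (MeromorphicAt.const 1 s))

/-- The meromorphic continuation of the spectral zeta function of the round 3-sphere. -/
noncomputable def spectralZeta (s : ℂ) : ℂ := ∑' k, spectralTerm k s

lemma spectralZeta_eqOn {R : ℝ} (hR : 0 < R) {N : ℕ} (hN : R + 2 ≤ N) :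
    Set.EqOn spectralZeta (fun s => ∑ k ∈ Finset.range N, spectralTerm k s +
      ∑' k, spectralTerm (k + N) s) (Metric.ball 0 R) := fun s hs => by
  obtain ⟨u, hu, hle⟩ := exists_summable_bound hR hN
  have h := Summable.of_norm_bounded hu fun k => hle k s hs
  have h' : Summable fun k => spectralTerm k s := (summable_nat_add_iff N).1 h
  exact (h'.sum_add_tsum_nat_add N).symm

lemma meromorphicAt_spectralZeta (s : ℂ) : MeromorphicAt spectralZeta s := by
  have hR : 0 < ‖s‖ + 1 := by positivity
  obtain ⟨N, hN⟩ := exists_nat_ge (‖s‖ + 1 + 2)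
  obtain ⟨u, hu, hle⟩ := exists_summable_bound hR hN
  have hmem : Metric.ball (0 : ℂ) (‖s‖ + 1) ∈ 𝓝 s :=
    Metric.isOpen_ball.mem_nhds (by simp)
  have htail : MeromorphicAt (fun s => ∑' k, spectralTerm (k + N) s) s :=
    ((differentiableOn_tsum_of_summable_norm hu (differentiableOn_spectralTerm hN)
      Metric.isOpen_ball hle).analyticAt hmem).meromorphicAt
  have hsum : MeromorphicAt (fun s => ∑ k ∈ Finset.range N, spectralTerm k s) s :=
    MeromorphicAt.fun_sum fun k _ => meromorphicAt_spectralTerm k s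
  exact (hsum.fun_add htail).congr
    (((spectralZeta_eqOn hR hN).symm.eventuallyEq_of_mem hmem).filter_mono nhdsWithin_le_nhds)

lemma spectralZeta_zero : spectralZeta 0 = -1 := by
  rw [spectralZeta, tsum_eq_single 0]
  · have := riemannZeta_neg_two_mul_nat_add_one 0
    simp only [Nat.cast_zero, zero_add, mul_one] at this
    simp [spectralTerm, risingCoeff, this]
  · intro k hk
    obtain ⟨k, rfl⟩ := Nat.exists_eq_succ_of_ne_zero hk
    simp [spectralTerm, risingCoeff_succ_zero]

lemma hasDerivAt_spectralTerm_zero :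
    HasDerivAt (spectralTerm 0) (2 * deriv riemannZeta (-2)) 0 := by
  have h1 : HasDerivAt riemannZeta (deriv riemannZeta (-2)) (2 * 0 + (2 * ((0 : ℕ) : ℂ) - 2)) := by
    have := (differentiableAt_riemannZeta (s := -2) (by norm_num)).hasDerivAt
    simpa using this
  have h2 : HasDerivAt (fun s : ℂ => 2 * s + (2 * ((0 : ℕ) : ℂ) - 2)) 2 0 := by
    simpa using ((hasDerivAt_id' (0 : ℂ)).const_mul 2)
  have h3 := (h1.comp 0 h2).sub_const 1
  rw [mul_comm (deriv _ _)] at h3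
  convert! h3 using 1
  ext s
  simp [spectralTerm, risingCoeff]

lemma hasDerivAt_spectralTerm_succ (k : ℕ) :
    HasDerivAt (spectralTerm (k + 1)) ((riemannZeta (2 * k) - 1) / ((k : ℂ) + 1)) 0 := by
  have hne : 2 * (0 : ℂ) + (2 * (k + 1 : ℕ) - 2) ≠ 1 := by
    intro h
    have : ((2 * k : ℕ) : ℂ) = (1 : ℕ) := by
      push_cast at h ⊢
      linear_combination h
    have := Nat.cast_injective this
    omega
  have h1 := (DifferentiableAt.comp (0 : ℂ) (differentiableAt_riemannZeta hne)
    (f := fun s : ℂ => 2 * s + (2 * ((k + 1 : ℕ) : ℂ) - 2)) (by fun_prop)).hasDerivAt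
  have h := (hasDerivAt_risingCoeff_succ_zero k).fun_mul (h1.sub_const 1)
  convert! h using 1
  rw [risingCoeff_succ_zero]
  simp only [Function.comp_apply]
  rw [show 2 * (0 : ℂ) + (2 * (k + 1 : ℕ) - 2) = 2 * k by push_cast; ring]
  ring

lemma hasDerivAt_spectralZeta_zero :
    HasDerivAt spectralZeta (2 * deriv riemannZeta (-2) + (-Real.log Real.pi : ℝ)) 0 := by
  have hN : (1 : ℝ) + 2 ≤ (3 : ℕ) := by norm_num
  obtain ⟨u, hu, hle⟩ := exists_summable_bound one_pos hN
  have hmem : Metric.ball (0 : ℂ) 1 ∈ 𝓝 0 := Metric.ball_mem_nhds _ one_pos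
  have hd := differentiableOn_spectralTerm hN
  have htail := ((differentiableOn_tsum_of_summable_norm hu hd
      Metric.isOpen_ball hle).differentiableAt hmem).hasDerivAt
  have htsum := hasSum_deriv_of_summable_norm hu hd Metric.isOpen_ball hle
    (Metric.mem_ball_self one_pos)
  have hdiff : ∀ k, DifferentiableAt ℂ (spectralTerm k) 0
    | 0 => hasDerivAt_spectralTerm_zero.differentiableAt
    | k + 1 => (hasDerivAt_spectralTerm_succ k).differentiableAt
  have hfin := HasDerivAt.fun_sum (u := Finset.range 3) fun k _ => (hdiff k).hasDerivAt
  have hval : HasSum (fun k => deriv (spectralTerm k) 0)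
      (2 * deriv riemannZeta (-2) + (-Real.log Real.pi : ℝ)) := by
    rw [← hasSum_nat_add_iff' 1]
    simpa [(hasDerivAt_spectralTerm_succ _).deriv, hasDerivAt_spectralTerm_zero.deriv] using
      hasSum_zeta_two_mul_sub_one
  have hall := (hasSum_nat_add_iff (f := fun k => deriv (spectralTerm k) 0) 3).1 htsum
  have heq := hall.unique hval
  rw [← heq, add_comm]
  exact (hfin.fun_add htail).congr_of_eventuallyEq
    ((spectralZeta_eqOn one_pos hN).eventuallyEq_of_mem hmem)

lemma summable_spectralTerm_double {s : ℂ} (hs : 3 / 2 < s.re) :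
    Summable fun p : ℕ × ℕ =>
      risingCoeff p.2 s * (1 / ((p.1 : ℂ) + 2) ^ (2 * s + (2 * p.2 - 2))) := by
  have hR : 0 < ‖s‖ + 1 := by positivity
  refine Summable.of_norm_bounded (Summable.mul_of_nonneg
    (summable_one_div_nat_add_two_rpow (x := 2 * s.re - 2) (by linarith))
    (summable_risingCoeff_mul_pow hR (x := 1 / 4) (by norm_num) (by norm_num))
    (fun n => by positivity)
    fun k => mul_nonneg (risingCoeff_pos k hR).le (by positivity)) fun p => ?_
  have h2 : (0 : ℝ) < p.1 + 2 := by positivity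
  rw [norm_mul, norm_div, norm_one, norm_nat_add_two_cpow, re_two_mul_add]
  calc _ ≤ risingCoeff p.2 (‖s‖ + 1) * (1 / (((p.1 : ℝ) + 2) ^ (2 * s.re - 2) * 4 ^ p.2)) := by
        gcongr
        · exact (risingCoeff_pos _ hR).le
        · exact norm_risingCoeff_le _ (by linarith)
        · rw [show 2 * s.re + (2 * p.2 - 2) = 2 * s.re - 2 + (2 * p.2 : ℕ) by push_cast; ring,
            Real.rpow_add h2, Real.rpow_natCast, pow_mul]
          gcongr
          nlinarith [p.1.cast_nonneg (α := ℝ)]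
    _ = _ := by
        rw [one_div_pow]
        field_simp

lemma hasSum_binomial_expansion (s : ℂ) (n : ℕ) :
    HasSum (fun k : ℕ => risingCoeff k s * (1 / ((n : ℂ) + 2) ^ (2 * s + (2 * k - 2))))
      (((n : ℂ) + 2) ^ 2 * (((n : ℂ) + 1) * ((n : ℂ) + 3)) ^ (-s)) := by
  have h0 : (n : ℂ) + 2 ≠ 0 := by exact_mod_cast (n + 1).succ_ne_zero
  have hx : 1 / ((n : ℝ) + 2) ^ 2 < 1 := by
    rw [div_lt_one (by positivity)]
    nlinarith [n.cast_nonneg (α := ℝ)]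
  have hz : (1 / ((n : ℂ) + 2) ^ 2) = ((1 / ((n : ℝ) + 2) ^ 2 : ℝ) : ℂ) := by push_cast; rfl
  have h := (hasSum_risingCoeff_mul_pow s (z := 1 / ((n : ℂ) + 2) ^ 2)
    (by rw [hz, norm_real, Real.norm_of_nonneg (by positivity)]; exact hx)).mul_left
      (((n : ℂ) + 2) ^ 2 * (((n : ℂ) + 2) ^ 2) ^ (-s))
  have hsq : (((n : ℂ) + 2) ^ 2) ^ (-s) = ((n : ℂ) + 2) ^ (-(2 * s)) := by
    have := natCast_cpow_natCast_mul (n + 2) 2 (-s)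
    push_cast at this
    rw [neg_mul_eq_mul_neg, this]
  have hprod : (((n : ℂ) + 1) * ((n : ℂ) + 3)) ^ (-s) =
      (((n : ℂ) + 2) ^ 2) ^ (-s) * (1 - 1 / ((n : ℂ) + 2) ^ 2) ^ (-s) := by
    have := mul_cpow_ofReal_nonneg (a := ((n : ℝ) + 2) ^ 2) (b := 1 - 1 / ((n : ℝ) + 2) ^ 2)
      (by positivity) (by linarith) (-s)
    push_cast at this
    rw [← this]
    congr 1
    field_simp
    ring
  rw [hprod, ← mul_assoc]
  convert! h using 2 with k
  have hexp : ((n : ℂ) + 2) ^ (2 * s + (2 * k - 2)) * ((n : ℂ) + 2) ^ 2 =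
      ((n : ℂ) + 2) ^ (2 * s) * (((n : ℂ) + 2) ^ 2) ^ k := by
    rw [← pow_mul, ← cpow_natCast _ 2, ← cpow_natCast _ (2 * k), ← cpow_add _ _ h0,
      ← cpow_add _ _ h0]
    congr 1
    push_cast
    ring
  have h1 : ((n : ℂ) + 2) ^ (2 * s + (2 * k - 2)) ≠ 0 := by simp [cpow_eq_zero_iff, h0]
  have h2 : ((n : ℂ) + 2) ^ (2 * s) ≠ 0 := by simp [cpow_eq_zero_iff, h0]
  have h3 : (((n : ℂ) + 2) ^ 2) ^ k ≠ 0 := by simp [h0]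
  rw [hsq, cpow_neg, one_div_pow]
  generalize ((n : ℂ) + 2) ^ (2 * s + (2 * k - 2)) = a at *
  generalize ((n : ℂ) + 2) ^ (2 * s) = b at *
  generalize (((n : ℂ) + 2) ^ 2) ^ k = c at *
  field_simp
  linear_combination -risingCoeff k s * hexp

lemma hasSum_spectralZeta {s : ℂ} (hs : 3 / 2 < s.re) :
    HasSum (fun n : ℕ => ((n : ℂ) + 2) ^ 2 * (((n : ℂ) + 1) * ((n : ℂ) + 3)) ^ (-s))
      (spectralZeta s) := by
  have h := summable_spectralTerm_double hs
  have h1 := h.hasSum.prod_fiberwise (hasSum_binomial_expansion s)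
  have hcol : ∀ k : ℕ, HasSum (fun n : ℕ =>
      risingCoeff k s * (1 / ((n : ℂ) + 2) ^ (2 * s + (2 * k - 2)))) (spectralTerm k s) :=
    fun k => by
      refine (hasSum_zeta_sub_one ?_).mul_left _
      rw [re_two_mul_add]
      linarith [k.cast_nonneg (α := ℝ)]
  have h2 := ((Equiv.prodComm ℕ ℕ).hasSum_iff.2 h.hasSum).prod_fiberwise hcol
  rw [spectralZeta, h2.tsum_eq]
  exact h1

/-- the spectral zeta function of the round 3-sphere,
`Z(s) = ∑_{n≥1} (n+1)²·(n(n+2))^{-s}`, converges absolutely for `Re s > 3`, and every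
analytic continuation `f` of the series to `0` satisfies `f(0) = −1` and
`f′(0) = 2·ζ′(−2) + 2·ζ′(0) + log 2`. -/
theorem stmt16 :
    (∀ s : ℂ, 3 < s.re →
      Summable (fun n : ℕ =>
        ‖((n : ℂ) + 2) ^ 2 * (((n : ℂ) + 1) * ((n : ℂ) + 3)) ^ (-s)‖)) ∧
    ∀ f : ℂ → ℂ,
      IsContinuationAt
        (fun s => ∑' n : ℕ, ((n : ℂ) + 2) ^ 2 * (((n : ℂ) + 1) * ((n : ℂ) + 3)) ^ (-s))
        3 0 f →
      f 0 = -1 ∧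
      deriv f 0 = 2 * deriv riemannZeta (-2) + 2 * deriv riemannZeta 0 + (Real.log 2 : ℂ) := by
  refine ⟨fun s hs => (hasSum_spectralZeta (by linarith)).summable.norm, ?_⟩
  rintro f ⟨U, -, hUc, h0, hhalf, hf, hF⟩
  have heq : ∀ s : ℂ, 3 < s.re → f s = spectralZeta s := fun s hs =>
    (hF s hs).trans (hasSum_spectralZeta (by linarith)).tsum_eq
  have hmero : MeromorphicOn (f - spectralZeta) U := fun s hs =>
    (hf s hs).meromorphicAt.sub (meromorphicAt_spectralZeta s)
  have htop : meromorphicOrderAt (f - spectralZeta) 0 = ⊤ := by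
    by_contra hne
    refine (hmero.exists_meromorphicOrderAt_ne_top_iff_forall hUc).1 ⟨⟨0, h0⟩, hne⟩
      ⟨4, hhalf (by norm_num)⟩ (meromorphicOrderAt_eq_top_iff.2 ?_)
    have : ∀ᶠ s : ℂ in 𝓝 4, 3 < s.re :=
      continuous_re.continuousAt.eventually_const_lt (by norm_num)
    filter_upwards [this.filter_mono nhdsWithin_le_nhds] with s hs
    exact sub_eq_zero.2 (heq s hs)
  have hpunct : f =ᶠ[𝓝[≠] 0] spectralZeta :=
    (meromorphicOrderAt_eq_top_iff.1 htop).mono fun _ h => sub_eq_zero.1 h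
  have hnhds : f =ᶠ[𝓝 0] spectralZeta :=
    ((hf 0 h0).continuousAt.eventuallyEq_nhds_iff_eventuallyEq_nhdsNE
      hasDerivAt_spectralZeta_zero.continuousAt).1 hpunct
  refine ⟨hnhds.eq_of_nhds.trans spectralZeta_zero, ?_⟩
  have hlog : Complex.log (2 * Real.pi) = (Real.log 2 + Real.log Real.pi : ℝ) := by
    rw [← Real.log_mul two_ne_zero Real.pi_ne_zero, ofReal_log (by positivity)]
    push_cast
    rfl
  rw [hnhds.deriv_eq, hasDerivAt_spectralZeta_zero.deriv, deriv_riemannZeta_zero, hlog]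
  push_cast
  ring
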